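/- Let k be an algebraically closed field of characteristic zero and let L = I_d − Σ_{j=1}^g A_j x_j be a monic linear pencil of size d ≥ 2, regarded as an element of M_d(k⟨x₁,…,x_g⟩). Set n₂ = 1 if d = 2 and n₂ = ⌈(d−1)·√(2(d−1)²/(d−2) + 1/4) + (d−1)/2 − 2⌉ if d ≥ 3. If there exists n ≥ n₂ such that det L(gX^(n)) ∈ k[ξ] is an irreducible polynomial, then L is an atom in M_d(k⟨x⟩). -/

import Mathlib

open Matrix MvPolynomial

noncomputable section

/-- Evaluation of the monic linear pencil `L = I_d - ∑ j, A j * x j` at a `g`-tuple `X` of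
`n × n` matrices over a commutative `k`-algebra `R`, via the Kronecker product. -/
def pencilEval {k : Type*} [CommRing k] {g d n : ℕ} {R : Type*} [CommRing R] [Algebra k R]
    (A : Fin g → Matrix (Fin d) (Fin d) k) (X : Fin g → Matrix (Fin n) (Fin n) R) :
    Matrix (Fin d × Fin n) (Fin d × Fin n) R :=
  1 - ∑ j, Matrix.kroneckerMap (· * ·) ((A j).map fun a => algebraMap k R a) (X j)

/-- The `g`-tuple of `n × n` generic matrices. -/
def genX (k : Type*) [CommRing k] (g n : ℕ) :
    Fin g → Matrix (Fin n) (Fin n) (MvPolynomial (Fin g × Fin n × Fin n) k) :=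
  fun j => Matrix.of fun ι κ => MvPolynomial.X (j, ι, κ)

/-- A monic linear pencil as a matrix over the free algebra. -/
def pencilMat {k : Type*} [CommRing k] {g d : ℕ} (A : Fin g → Matrix (Fin d) (Fin d) k) :
    Matrix (Fin d) (Fin d) (FreeAlgebra k (Fin g)) :=
  1 - ∑ j, (A j).map fun a => a • FreeAlgebra.ι k j

/-- An atom of a matrix ring: a non-invertible element that is not a product of two
non-invertible elements. -/
def MatAtom {R : Type*} [Ring R] {d : ℕ} (f : Matrix (Fin d) (Fin d) R) : Prop :=
  ¬IsUnit f ∧ ∀ u v : Matrix (Fin d) (Fin d) R, f = u * v → IsUnit u ∨ IsUnit v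

namespace FreeAlgebra

variable {k σ : Type*} [Field k] [DecidableEq σ]

/-- The algebra homomorphism to `2 × 2` upper triangular matrices whose off-diagonal entry
is the left derivative with respect to `x j`. -/
def leftDerivHom (j : σ) : FreeAlgebra k σ →ₐ[k] Matrix (Fin 2) (Fin 2) (FreeAlgebra k σ) :=
  FreeAlgebra.lift k fun i => !![0, if i = j then 1 else 0; 0, ι k i]

/-- The operator removing a leading letter `x j` from every word and killing all words that
do not start with `x j`. -/
def leftDeriv (j : σ) : FreeAlgebra k σ →ₗ[k] FreeAlgebra k σ where
  toFun p := leftDerivHom j p 0 1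
  map_add' p q := by simp
  map_smul' c p := by simp

lemma leftDerivHom_apply (j : σ) (p : FreeAlgebra k σ) :
    leftDerivHom j p = !![algebraMap k _ (algebraMapInv p), leftDeriv j p; 0, p] := by
  have h : leftDerivHom j p 0 0 = algebraMap k _ (algebraMapInv p) ∧
      leftDerivHom j p 1 0 = 0 ∧ leftDerivHom j p 1 1 = p := by
    induction p using FreeAlgebra.induction with
    | grade0 r => simp [Matrix.algebraMap_matrix_apply, algebraMapInv]
    | grade1 x => simp [leftDerivHom, algebraMapInv]
    | mul a b ha hb =>
      obtain ⟨ha0, ha1, ha2⟩ := ha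
      obtain ⟨hb0, hb1, hb2⟩ := hb
      simp [Matrix.mul_apply, Fin.sum_univ_two, *]
    | add a b ha hb =>
      obtain ⟨ha0, ha1, ha2⟩ := ha
      obtain ⟨hb0, hb1, hb2⟩ := hb
      simp [*]
  obtain ⟨h0, h1, h2⟩ := h
  ext a b
  fin_cases a <;> fin_cases b <;> simp [h0, h1, h2, leftDeriv]

lemma leftDeriv_mul (j : σ) (p q : FreeAlgebra k σ) :
    leftDeriv j (p * q) = leftDeriv j p * q + algebraMapInv p • leftDeriv j q := by
  have h : leftDeriv j (p * q) = (leftDerivHom j p * leftDerivHom j q) 0 1 := by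
    rw [← map_mul]; rfl
  rw [h, leftDerivHom_apply, leftDerivHom_apply, Algebra.smul_def]
  simp [Matrix.mul_apply, Fin.sum_univ_two, add_comm]

@[simp]
lemma leftDeriv_algebraMap (j : σ) (c : k) :
    leftDeriv j (algebraMap k (FreeAlgebra k σ) c) = 0 := by
  simp [leftDeriv, Matrix.algebraMap_matrix_apply]

lemma leftDeriv_ι (j i : σ) : leftDeriv j (ι k i) = if i = j then 1 else 0 := by
  simp [leftDeriv, leftDerivHom]

lemma leftDeriv_ι_mul (j i : σ) (p : FreeAlgebra k σ) :
    leftDeriv j (ι k i * p) = if i = j then p else 0 := by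
  rw [leftDeriv_mul, leftDeriv_ι]
  simp [algebraMapInv]

lemma eq_algebraMap_add_sum_leftDeriv [Fintype σ] (p : FreeAlgebra k σ) :
    p = algebraMap k _ (algebraMapInv p) + ∑ j, ι k j * leftDeriv j p := by
  induction p using FreeAlgebra.induction with
  | grade0 r => simp [algebraMapInv]
  | grade1 x => simp [algebraMapInv, leftDeriv_ι]
  | mul a b ha hb =>
    have h : ∑ j, ι k j * leftDeriv j (a * b) = (∑ j, ι k j * leftDeriv j a) * b +
        algebraMap k _ (algebraMapInv a) * ∑ j, ι k j * leftDeriv j b := by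
      simp only [leftDeriv_mul, mul_add, Finset.sum_add_distrib, Finset.sum_mul, Finset.mul_sum,
        mul_assoc, ← Algebra.smul_def, mul_smul_comm]
    rw [h, map_mul, map_mul, eq_sub_of_add_eq ha.symm, eq_sub_of_add_eq hb.symm]
    noncomm_ring
  | add a b ha hb =>
    nth_rw 1 [ha, hb]
    simp only [map_add, mul_add, Finset.sum_add_distrib]
    abel

variable (k σ) in
/-- The noncommutative polynomials of degree at most `m`. -/
def degreeLE : ℕ → Submodule k (FreeAlgebra k σ)
  | 0 => 1
  | m + 1 => ⨅ j, (degreeLE m).comap (leftDeriv j)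

lemma mem_degreeLE_zero {p : FreeAlgebra k σ} :
    p ∈ degreeLE k σ 0 ↔ ∃ c, algebraMap k _ c = p := by
  simp [degreeLE, Submodule.mem_one]

lemma mem_degreeLE_succ {m : ℕ} {p : FreeAlgebra k σ} :
    p ∈ degreeLE k σ (m + 1) ↔ ∀ j, leftDeriv j p ∈ degreeLE k σ m := by
  simp [degreeLE]

lemma algebraMap_mem_degreeLE (m : ℕ) (c : k) :
    algebraMap k _ c ∈ degreeLE k σ m := by
  cases m with
  | zero => exact mem_degreeLE_zero.2 ⟨c, rfl⟩
  | succ m => exact mem_degreeLE_succ.2 fun j => by simp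

lemma degreeLE_mono : Monotone (degreeLE k σ) := by
  refine monotone_nat_of_le_succ fun m => ?_
  induction m with
  | zero =>
    intro p hp
    obtain ⟨c, rfl⟩ := mem_degreeLE_zero.1 hp
    exact algebraMap_mem_degreeLE _ c
  | succ m ih =>
    intro p hp
    exact mem_degreeLE_succ.2 fun j => ih (mem_degreeLE_succ.1 hp j)

lemma mul_mem_degreeLE {m l : ℕ} {p q : FreeAlgebra k σ} (hp : p ∈ degreeLE k σ m)
    (hq : q ∈ degreeLE k σ l) : p * q ∈ degreeLE k σ (m + l) := by
  induction m generalizing p with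
  | zero =>
    obtain ⟨c, rfl⟩ := mem_degreeLE_zero.1 hp
    rw [← Algebra.smul_def, zero_add]
    exact Submodule.smul_mem _ _ hq
  | succ m ih =>
    rw [Nat.add_right_comm]
    refine mem_degreeLE_succ.2 fun j => ?_
    rw [leftDeriv_mul]
    refine Submodule.add_mem _ (ih (mem_degreeLE_succ.1 hp j)) (Submodule.smul_mem _ _ ?_)
    refine degreeLE_mono (Nat.le_add_left l m) ?_
    exact mem_degreeLE_succ.1 (degreeLE_mono (Nat.le_succ l) hq) j

lemma exists_mem_degreeLE (p : FreeAlgebra k σ) : ∃ m, p ∈ degreeLE k σ m := by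
  induction p using FreeAlgebra.induction with
  | grade0 r => exact ⟨0, algebraMap_mem_degreeLE 0 r⟩
  | grade1 x =>
    refine ⟨1, mem_degreeLE_succ.2 fun j => mem_degreeLE_zero.2 ⟨if x = j then 1 else 0, ?_⟩⟩
    rw [leftDeriv_ι]
    split_ifs <;> simp
  | mul a b ha hb =>
    obtain ⟨m, hm⟩ := ha
    obtain ⟨l, hl⟩ := hb
    exact ⟨m + l, mul_mem_degreeLE hm hl⟩
  | add a b ha hb =>
    obtain ⟨m, hm⟩ := ha
    obtain ⟨l, hl⟩ := hb
    exact ⟨max m l, Submodule.add_mem _ (degreeLE_mono (le_max_left m l) hm)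
      (degreeLE_mono (le_max_right m l) hl)⟩

lemma exists_forall_mem_degreeLE {ι : Type*} [Fintype ι] (p : ι → FreeAlgebra k σ) :
    ∃ m, ∀ i, p i ∈ degreeLE k σ m := by
  choose m hm using fun i => exists_mem_degreeLE (p i)
  exact ⟨Finset.univ.sup m, fun i => degreeLE_mono (Finset.le_sup (Finset.mem_univ i)) (hm i)⟩

end FreeAlgebra

section RowModule

open FreeAlgebra

variable {k : Type*} [Field k] {g d : ℕ}

lemma exists_comp_eq_of_ker_le_ker {V V₁ V₂ : Type*} [AddCommGroup V] [Module k V]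
    [AddCommGroup V₁] [Module k V₁] [AddCommGroup V₂] [Module k V₂] (f : V →ₗ[k] V₁)
    (q : V →ₗ[k] V₂) (h : LinearMap.ker f ≤ LinearMap.ker q) :
    ∃ l : V₁ →ₗ[k] V₂, l ∘ₗ f = q := by
  obtain ⟨s, hs⟩ := ((LinearMap.ker f).liftQ f le_rfl).exists_leftInverse_of_injective
    (Submodule.ker_liftQ_eq_bot _ _ _ le_rfl)
  refine ⟨(LinearMap.ker f).liftQ q h ∘ₗ s, LinearMap.ext fun x => ?_⟩
  have hx : s (f x) = (LinearMap.ker f).mkQ x := by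
    simpa using LinearMap.congr_fun hs ((LinearMap.ker f).mkQ x)
  simp [hx]

lemma exists_linearMap_ker_eq {V : Type*} [AddCommGroup V] [Module k V] [FiniteDimensional k V]
    (W : Submodule k V) {n : ℕ} (hn : Module.finrank k V ≤ n + Module.finrank k W) :
    ∃ q : V →ₗ[k] (Fin n → k), LinearMap.ker q = W := by
  have hr : Module.finrank k (V ⧸ W) ≤ n := by
    have := W.finrank_quotient_add_finrank
    omega
  let b := Module.finBasis k (V ⧸ W)
  let f : (V ⧸ W) →ₗ[k] (Fin n → k) :=
    Function.ExtendByZero.linearMap k (Fin.castLE hr) ∘ₗ b.equivFun.toLinearMap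
  have hf : Function.Injective f := by
    refine Function.Injective.comp (g := Function.ExtendByZero.linearMap k (Fin.castLE hr))
      (fun u v huv => funext fun i => ?_) b.equivFun.injective
    have := congrFun huv (Fin.castLE hr i)
    change Function.extend (Fin.castLE hr) u (0 : Fin n → k) _ =
      Function.extend (Fin.castLE hr) v (0 : Fin n → k) _ at this
    simpa only [(Fin.castLE_injective hr).extend_apply] using this
  refine ⟨f ∘ₗ W.mkQ, ?_⟩
  rw [LinearMap.ker_comp, LinearMap.ker_eq_bot.2 hf, Submodule.comap_bot, Submodule.ker_mkQ]

/-- The left module generated by the rows of a matrix over the free algebra. -/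
def rowModule (H : Matrix (Fin d) (Fin d) (FreeAlgebra k (Fin g))) :
    Submodule (FreeAlgebra k (Fin g)) (Fin d → FreeAlgebra k (Fin g)) where
  carrier := {p | ∃ q, q ᵥ* H = p}
  zero_mem' := ⟨0, Matrix.zero_vecMul _⟩
  add_mem' := by
    rintro _ _ ⟨p, rfl⟩ ⟨q, rfl⟩
    exact ⟨p + q, Matrix.add_vecMul _ _ _⟩
  smul_mem' := by
    rintro a _ ⟨p, rfl⟩
    exact ⟨a • p, Matrix.smul_vecMul _ _ _⟩

lemma row_mem_rowModule (H : Matrix (Fin d) (Fin d) (FreeAlgebra k (Fin g))) (i : Fin d) :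
    H i ∈ rowModule H := ⟨Pi.single i 1, by simp; rfl⟩

lemma exists_mul_eq_of_forall_row_mem {H K : Matrix (Fin d) (Fin d) (FreeAlgebra k (Fin g))}
    (h : ∀ i, K i ∈ rowModule H) : ∃ P, P * H = K := by
  choose P hP using h
  refine ⟨Matrix.of P, ?_⟩
  ext i j
  rw [← hP i]
  rfl

lemma rowModule_mul_le (G H : Matrix (Fin d) (Fin d) (FreeAlgebra k (Fin g))) :
    rowModule (G * H) ≤ rowModule H := by
  rintro _ ⟨q, rfl⟩
  exact ⟨q ᵥ* G, Matrix.vecMul_vecMul _ _ _⟩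

/-- A constant row vector over the free algebra. -/
def constRow (g : ℕ) (e : Fin d → k) : Fin d → FreeAlgebra k (Fin g) :=
  fun i => algebraMap k _ (e i)

lemma algebraMapInv_eq_zero_of_vecMul {H : Matrix (Fin d) (Fin d) (FreeAlgebra k (Fin g))}
    (hH : IsUnit (H.map algebraMapInv)) {q : Fin d → FreeAlgebra k (Fin g)}
    (hq : ∀ i, algebraMapInv ((q ᵥ* H) i) = 0) (i : Fin d) : algebraMapInv (q i) = 0 := by
  have h : (fun i => algebraMapInv (q i)) ᵥ* H.map algebraMapInv = 0 := by
    ext i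
    rw [Pi.zero_apply, ← hq i]
    simp [Matrix.vecMul, dotProduct]
  have h0 : (fun i => algebraMapInv (q i)) = 0 :=
    Matrix.vecMul_injective_of_isUnit hH (by simpa using h)
  exact congrFun h0 i

lemma leftDeriv_vecMul (H : Matrix (Fin d) (Fin d) (FreeAlgebra k (Fin g)))
    {q : Fin d → FreeAlgebra k (Fin g)} (hq : ∀ i, algebraMapInv (q i) = 0) (j : Fin g) :
    (fun i => leftDeriv j (q i)) ᵥ* H = fun i => leftDeriv j ((q ᵥ* H) i) := by
  ext i
  simp [Matrix.vecMul, dotProduct, leftDeriv_mul, hq]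

lemma leftDeriv_mem_rowModule {H : Matrix (Fin d) (Fin d) (FreeAlgebra k (Fin g))}
    (hH : IsUnit (H.map algebraMapInv)) {p : Fin d → FreeAlgebra k (Fin g)}
    (hp : p ∈ rowModule H) (h0 : ∀ i, algebraMapInv (p i) = 0) (j : Fin g) :
    (fun i => leftDeriv j (p i)) ∈ rowModule H := by
  obtain ⟨q, rfl⟩ := hp
  exact ⟨_, leftDeriv_vecMul H (algebraMapInv_eq_zero_of_vecMul hH h0) j⟩

lemma eq_zero_of_vecMul_eq_zero {H : Matrix (Fin d) (Fin d) (FreeAlgebra k (Fin g))}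
    (hH : IsUnit (H.map algebraMapInv)) {q : Fin d → FreeAlgebra k (Fin g)}
    (hq : q ᵥ* H = 0) : q = 0 := by
  obtain ⟨m, hm⟩ := exists_forall_mem_degreeLE q
  induction m generalizing q with
  | zero =>
    ext i
    have h0 := algebraMapInv_eq_zero_of_vecMul hH (q := q) (by simp [hq]) i
    obtain ⟨c, hc⟩ := mem_degreeLE_zero.1 (hm i)
    rw [← hc, algebraMap_leftInverse] at h0
    simp [← hc, h0]
  | succ m ih =>
    have h0 := algebraMapInv_eq_zero_of_vecMul hH (q := q) (by simp [hq])
    have hd : ∀ j, (fun i => leftDeriv j (q i)) = 0 := fun j =>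
      ih (by rw [leftDeriv_vecMul H h0, hq]; ext; simp) fun i => mem_degreeLE_succ.1 (hm i) j
    ext i
    rw [eq_algebraMap_add_sum_leftDeriv (q i), h0]
    simp [fun j => congrFun (hd j) i]

lemma eq_of_mul_eq_mul_right_of_isUnit_map {H : Matrix (Fin d) (Fin d) (FreeAlgebra k (Fin g))}
    (hH : IsUnit (H.map algebraMapInv)) {P Q : Matrix (Fin d) (Fin d) (FreeAlgebra k (Fin g))}
    (h : P * H = Q * H) : P = Q := by
  rw [← sub_eq_zero, ← sub_mul] at h
  rw [← sub_eq_zero]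
  exact funext fun i => eq_zero_of_vecMul_eq_zero hH (congrFun h i)

lemma map_algebraMapInv_pencilMat (A : Fin g → Matrix (Fin d) (Fin d) k) :
    (pencilMat A).map algebraMapInv = 1 := by
  ext i j
  simp [pencilMat, Matrix.sum_apply, algebraMapInv, Matrix.one_apply, apply_ite]

lemma constRow_vecMul_pencilMat (A : Fin g → Matrix (Fin d) (Fin d) k) (e : Fin d → k) :
    constRow g e ᵥ* pencilMat A = constRow g e - ∑ j, ι k j • constRow g (e ᵥ* A j) := by
  have h : ∀ j, constRow g e ᵥ* (A j).map (fun a => a • ι k j) =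
      ι k j • constRow g (e ᵥ* A j) := by
    intro j
    ext i
    simp only [Matrix.vecMul, dotProduct, constRow, Matrix.map_apply, Pi.smul_apply, map_sum,
      map_mul, smul_eq_mul, Finset.mul_sum]
    refine Finset.sum_congr rfl fun l _ => ?_
    rw [Algebra.smul_def, ← map_mul, ← mul_assoc, ← map_mul, Algebra.commutes]
  rw [pencilMat, Matrix.vecMul_sub, Matrix.vecMul_one, Matrix.vecMul_sum]
  simp only [h]

lemma constRow_mem_of_forall_vecMul_mem {A : Fin g → Matrix (Fin d) (Fin d) k}
    {T : Submodule (FreeAlgebra k (Fin g)) (Fin d → FreeAlgebra k (Fin g))}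
    (hT : rowModule (pencilMat A) ≤ T) {e : Fin d → k}
    (he : ∀ j, constRow g (e ᵥ* A j) ∈ T) : constRow g e ∈ T := by
  rw [eq_add_of_sub_eq (constRow_vecMul_pencilMat A e).symm]
  exact T.add_mem (hT ⟨_, rfl⟩) (T.sum_mem fun j _ => T.smul_mem _ (he j))

/-- If the row module of `H` contains that of a monic pencil, then it is generated by the rows
of the pencil together with the constant rows it contains. -/
lemma rowModule_le_of_constRow_mem {A : Fin g → Matrix (Fin d) (Fin d) k}
    {H : Matrix (Fin d) (Fin d) (FreeAlgebra k (Fin g))} (hH : IsUnit (H.map algebraMapInv))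
    (hAH : rowModule (pencilMat A) ≤ rowModule H)
    {T : Submodule (FreeAlgebra k (Fin g)) (Fin d → FreeAlgebra k (Fin g))}
    (hT : rowModule (pencilMat A) ≤ T)
    (hW : ∀ e : Fin d → k, constRow g e ∈ rowModule H → constRow g e ∈ T) :
    rowModule H ≤ T := by
  intro p hp
  obtain ⟨m, hm⟩ := exists_forall_mem_degreeLE p
  induction m generalizing p with
  | zero =>
    choose e he using fun i => mem_degreeLE_zero.1 (hm i)
    obtain rfl : constRow g e = p := funext he
    exact hW e hp
  | succ m ih =>
    let e : Fin d → k := fun i => algebraMapInv (p i)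
    let s : Fin g → Fin d → FreeAlgebra k (Fin g) := fun j =>
      (fun i => leftDeriv j (p i)) + constRow g (e ᵥ* A j)
    have hps : p = constRow g e ᵥ* pencilMat A + ∑ j, ι k j • s j := by
      rw [constRow_vecMul_pencilMat]
      ext i
      conv_lhs => rw [eq_algebraMap_add_sum_leftDeriv (p i)]
      simp [s, constRow, e, Finset.sum_add_distrib]
    have hr : ∑ j, ι k j • s j ∈ rowModule H := by
      rw [← sub_eq_of_eq_add' hps]
      exact Submodule.sub_mem _ hp (hAH ⟨_, rfl⟩)
    have hs : ∀ j, s j ∈ rowModule H := by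
      intro j
      convert leftDeriv_mem_rowModule hH hr (by simp [algebraMapInv]) j using 1
      ext i
      simp [leftDeriv_ι_mul]
    have hsT : ∀ j, s j ∈ T := fun j => ih (hs j) fun i =>
      Submodule.add_mem _ (mem_degreeLE_succ.1 (hm i) j) (algebraMap_mem_degreeLE _ _)
    rw [hps]
    exact T.add_mem (hT ⟨_, rfl⟩) (T.sum_mem fun j _ => T.smul_mem _ (hsT j))

/-- Evaluation of a row over the free algebra at a tuple of matrices, paired with a vector. -/
def evalRow {n : ℕ} (X : Fin g → Matrix (Fin n) (Fin n) k) (v : Fin d → Fin n → k) :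
    (Fin d → FreeAlgebra k (Fin g)) →ₗ[k] (Fin n → k) where
  toFun p := ∑ i, FreeAlgebra.lift k X (p i) *ᵥ v i
  map_add' p q := by simp [Matrix.add_mulVec, Finset.sum_add_distrib]
  map_smul' c p := by simp [Matrix.smul_mulVec, Finset.smul_sum]

lemma evalRow_apply {n : ℕ} (X : Fin g → Matrix (Fin n) (Fin n) k) (v : Fin d → Fin n → k)
    (p : Fin d → FreeAlgebra k (Fin g)) :
    evalRow X v p = ∑ i, FreeAlgebra.lift k X (p i) *ᵥ v i := rfl

lemma evalRow_smul {n : ℕ} (X : Fin g → Matrix (Fin n) (Fin n) k) (v : Fin d → Fin n → k)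
    (a : FreeAlgebra k (Fin g)) (p : Fin d → FreeAlgebra k (Fin g)) :
    evalRow X v (a • p) = FreeAlgebra.lift k X a *ᵥ evalRow X v p := by
  simp [evalRow_apply, Matrix.mulVec_sum, Matrix.mulVec_mulVec]

lemma evalRow_constRow {n : ℕ} (X : Fin g → Matrix (Fin n) (Fin n) k)
    (q : (Fin d → k) →ₗ[k] (Fin n → k)) (e : Fin d → k) :
    evalRow X (fun i => q (Pi.single i 1)) (constRow g e) = q e := by
  have h : e = ∑ i, e i • Pi.single i (1 : k) := pi_eq_sum_univ' e
  conv_rhs => rw [h, map_sum]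
  simp [evalRow_apply, constRow, Algebra.algebraMap_eq_smul_one, Matrix.smul_mulVec]

/-- The rows over the free algebra that annihilate a given vector upon evaluation. -/
def evalAnnihilator {n : ℕ} (X : Fin g → Matrix (Fin n) (Fin n) k) (v : Fin d → Fin n → k) :
    Submodule (FreeAlgebra k (Fin g)) (Fin d → FreeAlgebra k (Fin g)) where
  carrier := {p | evalRow X v p = 0}
  zero_mem' := map_zero _
  add_mem' {p q} hp hq := by
    change evalRow X v (p + q) = 0
    rw [map_add, show evalRow X v p = 0 from hp, show evalRow X v q = 0 from hq, add_zero]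
  smul_mem' a p hp := by
    change evalRow X v (a • p) = 0
    rw [evalRow_smul, show evalRow X v p = 0 from hp, Matrix.mulVec_zero]

lemma mem_evalAnnihilator {n : ℕ} {X : Fin g → Matrix (Fin n) (Fin n) k} {v : Fin d → Fin n → k}
    {p : Fin d → FreeAlgebra k (Fin g)} : p ∈ evalAnnihilator X v ↔ evalRow X v p = 0 := Iff.rfl

lemma eq_zero_of_rowModule_le_evalAnnihilator {n : ℕ} {X : Fin g → Matrix (Fin n) (Fin n) k}
    {v : Fin d → Fin n → k} {H : Matrix (Fin d) (Fin d) (FreeAlgebra k (Fin g))}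
    (hX : IsUnit (H.map (FreeAlgebra.lift k X))) (h : rowModule H ≤ evalAnnihilator X v) :
    v = 0 := by
  obtain ⟨P, hP⟩ := hX.exists_left_inv
  ext1 i
  have hrow : ∀ r, ∑ s, FreeAlgebra.lift k X (H r s) *ᵥ v s = 0 := fun r =>
    h (row_mem_rowModule H r)
  calc v i = ∑ s, (1 : Matrix (Fin d) (Fin d) (Matrix (Fin n) (Fin n) k)) i s *ᵥ v s := by
        rw [Finset.sum_eq_single i]
        · simp
        · intro s _ hs
          simp [Matrix.one_apply_ne' hs]
        · simp
    _ = ∑ r, P i r *ᵥ ∑ s, FreeAlgebra.lift k X (H r s) *ᵥ v s := by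
        simp only [← hP, Matrix.mul_apply, Matrix.map_apply, Matrix.sum_mulVec, Matrix.mulVec_sum,
          Matrix.mulVec_mulVec]
        exact Finset.sum_comm
    _ = 0 := by simp [hrow]

lemma isUnit_or_isUnit_of_forall_isUnit_map {n : ℕ} (hdn : d ≤ n + 1)
    (A : Fin g → Matrix (Fin d) (Fin d) k) {G H : Matrix (Fin d) (Fin d) (FreeAlgebra k (Fin g))}
    (hGH : pencilMat A = G * H)
    (hX : ∀ X : Fin g → Matrix (Fin n) (Fin n) k, IsUnit (H.map (FreeAlgebra.lift k X))) :
    IsUnit G ∨ IsUnit H := by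
  have hL : IsUnit ((pencilMat A).map algebraMapInv) := by
    rw [map_algebraMapInv_pencilMat]; exact isUnit_one
  have hH : IsUnit (H.map algebraMapInv) := by
    refine IsUnit.of_mul_eq_one_right (G.map algebraMapInv) ?_
    rw [← map_algebraMapInv_pencilMat A, hGH, Matrix.map_mul]
  have hAH : rowModule (pencilMat A) ≤ rowModule H := hGH ▸ rowModule_mul_le G H
  let W : Submodule k (Fin d → k) :=
    { carrier := {e | constRow g e ∈ rowModule H}
      zero_mem' := by
        have : constRow g (0 : Fin d → k) = 0 := by ext; simp [constRow]
        simp [this]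
      add_mem' := by
        intro a b ha hb
        have : constRow g (a + b) = constRow g a + constRow g b := by ext; simp [constRow]
        simpa [this] using Submodule.add_mem _ ha hb
      smul_mem' := by
        intro c a ha
        have : constRow g (c • a) = algebraMap k (FreeAlgebra k (Fin g)) c • constRow g a := by
          ext; simp [constRow]
        rw [Set.mem_ofPred_eq, this]
        exact Submodule.smul_mem _ _ ha }
  by_cases hW : W = ⊥
  · left
    have hle : rowModule H ≤ rowModule (pencilMat A) := by
      refine rowModule_le_of_constRow_mem hH hAH le_rfl fun e he => ?_
      have : e = 0 := by simpa [hW] using (show e ∈ W from he)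
      subst this
      have : constRow g (0 : Fin d → k) = 0 := by ext; simp [constRow]
      simp [this]
    obtain ⟨K, hK⟩ := exists_mul_eq_of_forall_row_mem fun i => hle (row_mem_rowModule H i)
    refine isUnit_iff_exists.2 ⟨K, ?_, ?_⟩
    · refine eq_of_mul_eq_mul_right_of_isUnit_map hL ?_
      rw [mul_assoc, hK, one_mul, hGH]
    · refine eq_of_mul_eq_mul_right_of_isUnit_map hH ?_
      rw [mul_assoc, ← hGH, hK, one_mul]
  · right
    have hfin : Module.finrank k (Fin d → k) ≤ n + Module.finrank k W := by
      have := Submodule.one_le_finrank_iff.2 hW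
      rw [Module.finrank_fin_fun]
      omega
    obtain ⟨q, hq⟩ := exists_linearMap_ker_eq W hfin
    obtain ⟨l, hl⟩ := exists_comp_eq_of_ker_le_ker
      (LinearMap.pi fun j => q ∘ₗ (A j).vecMulLinear) q (by
        intro e he
        rw [hq]
        refine constRow_mem_of_forall_vecMul_mem hAH fun j => ?_
        have : e ᵥ* A j ∈ LinearMap.ker q := congrFun he j
        rw [hq] at this
        exact this)
    let X : Fin g → Matrix (Fin n) (Fin n) k := fun j =>
      LinearMap.toMatrix' (l ∘ₗ LinearMap.single k (fun _ => Fin n → k) j)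
    have hlX : ∀ e, q e = ∑ j, X j *ᵥ q (e ᵥ* A j) := by
      intro e
      conv_lhs => rw [← hl]
      simp only [X, LinearMap.toMatrix'_mulVec, LinearMap.comp_apply, ← map_sum]
      congr 1
      exact (Finset.univ_sum_single _).symm
    let T := evalAnnihilator X (fun i => q (Pi.single i 1))
    have hLT : rowModule (pencilMat A) ≤ T := by
      have hconst : ∀ e : Fin d → k, constRow g e ᵥ* pencilMat A ∈ T := by
        intro e
        rw [mem_evalAnnihilator, constRow_vecMul_pencilMat, map_sub, map_sum]
        simp only [evalRow_smul, evalRow_constRow, FreeAlgebra.lift_ι_apply]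
        rw [sub_eq_zero]
        exact hlX e
      rintro _ ⟨p, rfl⟩
      have : p ᵥ* pencilMat A = ∑ i, p i • (constRow g (Pi.single i 1) ᵥ* pencilMat A) := by
        have hp : p = ∑ i, p i • constRow g (Pi.single i (1 : k)) := by
          ext i
          simp [constRow, Pi.single_apply, apply_ite]
        conv_lhs => rw [hp, Matrix.sum_vecMul]
        simp only [Matrix.smul_vecMul]
      rw [this]
      exact T.sum_mem fun i _ => T.smul_mem _ (hconst _)
    have hHT : rowModule H ≤ T := rowModule_le_of_constRow_mem hH hAH hLT fun e he => by
      have : e ∈ LinearMap.ker q := by rw [hq]; exact he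
      rw [mem_evalAnnihilator, evalRow_constRow]
      exact this
    have hv : ∀ i, q (Pi.single i 1) = 0 :=
      congrFun (eq_zero_of_rowModule_le_evalAnnihilator (hX X) hHT)
    have htop : ∀ e : Fin d → k, constRow g e ∈ rowModule H := by
      intro e
      have hq0 : q = 0 := LinearMap.pi_ext' fun i => LinearMap.ext_ring (by simpa using hv i)
      have : e ∈ W := by rw [← hq, hq0]; simp
      exact this
    obtain ⟨P, hP⟩ := exists_mul_eq_of_forall_row_mem (H := H) (K := 1) fun i => by
      convert htop (Pi.single i 1) using 1
      ext j
      simp [constRow, Matrix.one_apply, Pi.single_apply, apply_ite, eq_comm]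
    refine isUnit_iff_exists.2 ⟨P, ?_, hP⟩
    refine eq_of_mul_eq_mul_right_of_isUnit_map hH ?_
    rw [mul_assoc, hP, one_mul, mul_one]

lemma star_pencilMat (A : Fin g → Matrix (Fin d) (Fin d) k) :
    (pencilMat A)ᴴ = pencilMat fun j => (A j)ᵀ := by
  ext i j
  simp only [pencilMat, Matrix.conjTranspose_apply, Matrix.sub_apply, Matrix.sum_apply,
    Matrix.map_apply, Matrix.transpose_apply, star_sub, star_sum, Algebra.smul_def, star_mul,
    FreeAlgebra.star_algebraMap, FreeAlgebra.star_ι, Matrix.one_apply, eq_comm (a := i)]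
  congr 1
  · split_ifs <;> simp
  · exact Finset.sum_congr rfl fun l _ => (Algebra.commutes _ _).symm

lemma lift_star {n : ℕ} (X : Fin g → Matrix (Fin n) (Fin n) k) (p : FreeAlgebra k (Fin g)) :
    FreeAlgebra.lift k X (star p) = (FreeAlgebra.lift k (fun j => (X j)ᵀ) p)ᵀ := by
  induction p using FreeAlgebra.induction with
  | grade0 r =>
    rw [FreeAlgebra.star_algebraMap, AlgHom.commutes, AlgHom.commutes,
      Algebra.algebraMap_eq_smul_one, Matrix.transpose_smul, Matrix.transpose_one]
  | grade1 x => simp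
  | mul a b ha hb => simp [ha, hb]
  | add a b ha hb => simp [ha, hb]

lemma isUnit_conjTranspose_map_lift {n : ℕ} (X : Fin g → Matrix (Fin n) (Fin n) k)
    {G : Matrix (Fin d) (Fin d) (FreeAlgebra k (Fin g))}
    (hG : IsUnit (G.map (FreeAlgebra.lift k fun j => (X j)ᵀ))) :
    IsUnit (Gᴴ.map (FreeAlgebra.lift k X)) := by
  rw [← MulEquiv.isUnit_map (Matrix.compRingEquiv (Fin d) (Fin n) k)] at hG ⊢
  rw [← Matrix.isUnit_transpose] at hG
  convert hG using 1
  ext ⟨a, b⟩ ⟨a', b'⟩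
  simp [Matrix.comp_apply, lift_star]

/-- Evaluation of a matrix over the free algebra at a tuple of matrices, as a block matrix. -/
def evalBlock {R : Type*} [CommRing R] [Algebra k R] {n : ℕ}
    (X : Fin g → Matrix (Fin n) (Fin n) R) :
    Matrix (Fin d) (Fin d) (FreeAlgebra k (Fin g)) →+* Matrix (Fin d × Fin n) (Fin d × Fin n) R :=
  (Matrix.compRingEquiv (Fin d) (Fin n) R).toRingHom.comp
    (FreeAlgebra.lift k X).toRingHom.mapMatrix

lemma evalBlock_apply {R : Type*} [CommRing R] [Algebra k R] {n : ℕ}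
    (X : Fin g → Matrix (Fin n) (Fin n) R) (G : Matrix (Fin d) (Fin d) (FreeAlgebra k (Fin g)))
    (a b : Fin d × Fin n) :
    evalBlock X G a b = FreeAlgebra.lift k X (G a.1 b.1) a.2 b.2 := rfl

lemma evalBlock_pencilMat {R : Type*} [CommRing R] [Algebra k R] {n : ℕ}
    (A : Fin g → Matrix (Fin d) (Fin d) k) (X : Fin g → Matrix (Fin n) (Fin n) R) :
    evalBlock X (pencilMat A) = pencilEval A X := by
  ext ⟨a, b⟩ ⟨a', b'⟩
  rw [evalBlock_apply]
  simp only [pencilMat, pencilEval, Matrix.sub_apply, Matrix.sum_apply, Matrix.map_apply, map_sub,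
    map_sum, map_smul, FreeAlgebra.lift_ι_apply, Matrix.smul_apply, Matrix.kroneckerMap_apply,
    ← Algebra.smul_def]
  congr 1
  by_cases h : a = a'
  · subst h
    simp [Matrix.one_apply]
  · simp [h]

lemma isUnit_map_lift_of_isUnit_det_genX {n : ℕ}
    {G : Matrix (Fin d) (Fin d) (FreeAlgebra k (Fin g))}
    (hG : IsUnit (evalBlock (genX k g n) G).det) (X : Fin g → Matrix (Fin n) (Fin n) k) :
    IsUnit (G.map (FreeAlgebra.lift k X)) := by
  let φ : MvPolynomial (Fin g × Fin n × Fin n) k →ₐ[k] k :=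
    MvPolynomial.aeval fun t => X t.1 t.2.1 t.2.2
  have hφ : FreeAlgebra.lift k X = φ.mapMatrix.comp (FreeAlgebra.lift k (genX k g n)) := by
    ext j a b
    simp [genX, φ]
  rw [← MulEquiv.isUnit_map (Matrix.compRingEquiv (Fin d) (Fin n) k)]
  have h := (((Matrix.isUnit_iff_isUnit_det _).2 hG).map φ.toRingHom.mapMatrix)
  convert h using 1
  ext ⟨a, b⟩ ⟨a', b'⟩
  simp [Matrix.comp_apply, hφ, evalBlock_apply]

end RowModule

lemma le_succ_of_ceil_le {d n : ℕ} (hd : 2 ≤ d)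
    (hn : (if d = 2 then (1 : ℤ) else
      ⌈((d : ℝ) - 1) * Real.sqrt (2 * ((d : ℝ) - 1) ^ 2 / ((d : ℝ) - 2) + 1 / 4) +
        ((d : ℝ) - 1) / 2 - 2⌉) ≤ (n : ℤ)) : d ≤ n + 1 := by
  split_ifs at hn with h
  · omega
  · have hd3 : (3 : ℝ) ≤ d := by exact_mod_cast (by omega : 3 ≤ d)
    have hs : (2 : ℝ) ≤ Real.sqrt (2 * ((d : ℝ) - 1) ^ 2 / ((d : ℝ) - 2) + 1 / 4) := by
      refine Real.le_sqrt_of_sq_le ?_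
      have : (4 : ℝ) ≤ 2 * ((d : ℝ) - 1) ^ 2 / ((d : ℝ) - 2) := by
        rw [le_div_iff₀ (by linarith)]
        nlinarith
      linarith
    have h1 := Int.ceil_le.1 hn
    push_cast at h1
    have h2 : (d : ℝ) ≤ n + 1 := by nlinarith
    exact_mod_cast h2

/-- If `L` is a monic pencil of size `d ≥ 2` and `det L(gX⁽ⁿ⁾)` is irreducible for some
`n ≥ n₂` (with `n₂` as below), then `L` is an atom in `M_d(k⟨x⟩)`. -/
theorem pencil_atom_of_det_genericMatrices_irreducible
    {k : Type*} [Field k] [IsAlgClosed k] [CharZero k] {g d : ℕ} (hd : 2 ≤ d)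
    (A : Fin g → Matrix (Fin d) (Fin d) k) (n : ℕ)
    (hn : (if d = 2 then (1 : ℤ) else
      ⌈((d : ℝ) - 1) * Real.sqrt (2 * ((d : ℝ) - 1) ^ 2 / ((d : ℝ) - 2) + 1 / 4) +
        ((d : ℝ) - 1) / 2 - 2⌉) ≤ (n : ℤ))
    (hirr : Irreducible (pencilEval A (genX k g n)).det) :
    MatAtom (pencilMat A) := by
  have hdn : d ≤ n + 1 := le_succ_of_ceil_le hd hn
  rw [← evalBlock_pencilMat] at hirr
  refine ⟨fun h => hirr.not_isUnit
    ((Matrix.isUnit_iff_isUnit_det _).1 (h.map (evalBlock (genX k g n)))), fun u v huv => ?_⟩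
  rw [huv, map_mul, Matrix.det_mul] at hirr
  rcases hirr.isUnit_or_isUnit rfl with hu | hv
  · have hstar : pencilMat (fun j => (A j)ᵀ) = vᴴ * uᴴ := by
      rw [← star_pencilMat, huv, Matrix.conjTranspose_mul]
    have := isUnit_or_isUnit_of_forall_isUnit_map hdn _ hstar fun X =>
      isUnit_conjTranspose_map_lift X (isUnit_map_lift_of_isUnit_det_genX hu _)
    rw [← Matrix.star_eq_conjTranspose, ← Matrix.star_eq_conjTranspose, isUnit_star,
      isUnit_star] at this
    exact this.symm
  · exact isUnit_or_isUnit_of_forall_isUnit_map hdn A huv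
      (isUnit_map_lift_of_isUnit_det_genX hv)
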